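/- (Reversal signals.) Let s, δ_{t−1}, δ_t, δ_{t+1} be mutually independent centered real Gaussian random variables, where s has variance σ_s² ≥ 0 and each δ has variance σ_δ² > 0. Define the reversal signal error η = δ_t − δ_{t−1}, the observed signal ŝ = s + η with σ_ŝ = √(σ_s² + 2σ_δ²), the noise share ρ = √2·σ_δ/σ_ŝ, and the return measurement error ε = δ_{t+1} − δ_t. Let α ∈ (0,1) and let c_L, c_S be the real numbers with P(ŝ ≥ c_L) = α and P(ŝ ≤ c_S) = α. Then E[ε | ŝ ≥ c_L] − E[ε | ŝ ≤ c_S] = −√2·κ(α)·ρ·σ_δ; in particular the bias magnitude is |Bias| = √2·κ(α)·ρ·σ_δ. -/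

import Mathlib

open MeasureTheory ProbabilityTheory Real

noncomputable section

/-- The standard normal density `φ(z) = (1/√(2π))·exp(−z²/2)`. -/
def stdNormalPDF (z : ℝ) : ℝ := (Real.sqrt (2 * Real.pi))⁻¹ * Real.exp (-z ^ 2 / 2)

/-- Conditional mean of `X` given an event `A`: `E[X | A] = E[X · 1_A] / P(A)`. -/
def condMean {Ω : Type*} [MeasurableSpace Ω] (μ : Measure Ω) (A : Set Ω) (X : Ω → ℝ) : ℝ :=
  (∫ ω in A, X ω ∂μ) / (μ A).toReal

lemma stdNormalPDF_nonneg (z : ℝ) : 0 ≤ stdNormalPDF z := by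
  unfold stdNormalPDF; positivity

lemma gaussianPDFReal_zero_one (z : ℝ) : gaussianPDFReal 0 1 z = stdNormalPDF z := by
  simp [gaussianPDFReal, stdNormalPDF]

lemma hasDerivAt_neg_stdNormalPDF (z : ℝ) :
    HasDerivAt (fun x ↦ -stdNormalPDF x) (stdNormalPDF z * z) z := by
  have h : HasDerivAt (fun x : ℝ ↦ -x ^ 2 / 2) (-z) z := by
    refine ((hasDerivAt_pow 2 z).neg.div_const 2).congr_deriv ?_
    norm_num
    ring
  refine (h.exp.const_mul (Real.sqrt (2 * Real.pi))⁻¹).neg.congr_deriv ?_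
  unfold stdNormalPDF
  ring

lemma tendsto_stdNormalPDF_atBot :
    Filter.Tendsto stdNormalPDF Filter.atBot (nhds 0) := by
  have h : Filter.Tendsto (fun x : ℝ ↦ -x ^ 2 / 2) Filter.atBot Filter.atBot := by
    have hsq : Filter.Tendsto (fun x : ℝ ↦ x ^ 2) Filter.atBot Filter.atTop := by
      simpa [Function.comp_def] using
        (Filter.tendsto_pow_atTop (α := ℝ) two_ne_zero).comp Filter.tendsto_abs_atBot_atTop
    exact (Filter.tendsto_neg_atTop_atBot.comp hsq).atBot_div_const two_pos
  have hlim := (Real.tendsto_exp_atBot.comp h).const_mul (Real.sqrt (2 * Real.pi))⁻¹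
  rwa [mul_zero] at hlim

lemma integrable_stdNormalPDF_mul : Integrable (fun x ↦ stdNormalPDF x * x) := by
  have h := (integrable_mul_exp_neg_mul_sq (b := 1 / 2) (by norm_num)).const_mul
    (Real.sqrt (2 * Real.pi))⁻¹
  refine h.congr (Filter.Eventually.of_forall fun x ↦ ?_)
  simp only [stdNormalPDF]
  ring_nf

/-- The truncated first moment of the standard normal law. -/
lemma setIntegral_Iic_gaussianReal (q : ℝ) :
    ∫ x in Set.Iic q, x ∂(gaussianReal 0 1) = -stdNormalPDF q := by
  rw [← integral_indicator measurableSet_Iic,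
    integral_gaussianReal_eq_integral_smul one_ne_zero]
  have h : ∀ x : ℝ, gaussianPDFReal 0 1 x • (Set.Iic q).indicator (fun x ↦ x) x
      = (Set.Iic q).indicator (fun x ↦ stdNormalPDF x * x) x := fun x ↦ by
    by_cases hx : x ∈ Set.Iic q <;> simp [hx, gaussianPDFReal_zero_one]
  simp_rw [h]
  rw [integral_indicator measurableSet_Iic,
    integral_Iic_of_hasDerivAt_of_tendsto' (fun x _ ↦ hasDerivAt_neg_stdNormalPDF x)
      integrable_stdNormalPDF_mul.integrableOn (by simpa using tendsto_stdNormalPDF_atBot.neg),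
    sub_zero]

/-- The distribution function of a nondegenerate Gaussian law is strictly increasing. -/
lemma strictMono_cdf_gaussianReal (m : ℝ) {v : NNReal} (hv : v ≠ 0) :
    StrictMono (cdf (gaussianReal m v)) := by
  refine (monotone_cdf _).strictMono_of_injective fun a b hab ↦ ?_
  wlog hlt : a < b generalizing a b
  · rcases (not_lt.1 hlt).eq_or_lt with h | h
    · exact h.symm
    · exact (this b a hab.symm h).symm
  have h0 : gaussianReal m v (Set.Ioc a b) = 0 := by
    rw [← measure_cdf (gaussianReal m v), StieltjesFunction.measure_Ioc, hab, sub_self,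
      ENNReal.ofReal_zero]
  have h1 := gaussianReal_absolutelyContinuous' m hv h0
  rw [Real.volume_Ioc, ENNReal.ofReal_eq_zero] at h1
  linarith

/-- Gaussian regression on an event determined by a standardized regressor. -/
lemma ProbabilityTheory.HasGaussianLaw.setIntegral_eq_covariance_mul {Ω : Type*} [MeasurableSpace Ω]
    {μ : Measure Ω} {X Z : Ω → ℝ} (hXZ : HasGaussianLaw (fun ω ↦ (X ω, Z ω)) μ)
    (hZm : Measurable Z) (hX0 : μ[X] = 0) (hZ0 : μ[Z] = 0) (hZ1 : Var[Z; μ] = 1)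
    {B : Set ℝ} (hB : MeasurableSet B) :
    ∫ ω in Z ⁻¹' B, X ω ∂μ = cov[X, Z; μ] * ∫ ω in Z ⁻¹' B, Z ω ∂μ := by
  have := hXZ.isProbabilityMeasure
  set b := cov[X, Z; μ] with hb
  set R : Ω → ℝ := X - b • Z with hR
  have hX2 := hXZ.fst.memLp_two
  have hZ2 := hXZ.snd.memLp_two
  have hXi := hXZ.fst.integrable
  have hZi := hXZ.snd.integrable
  have hRZ : HasGaussianLaw (fun ω ↦ (R ω, Z ω)) μ :=
    hXZ.map ((ContinuousLinearMap.fst ℝ ℝ ℝ - b • ContinuousLinearMap.snd ℝ ℝ ℝ).prod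
      (ContinuousLinearMap.snd ℝ ℝ ℝ))
  have hcov : cov[R, Z; μ] = 0 := by
    rw [hR, covariance_sub_left hX2 (hZ2.const_smul b) hZ2, covariance_smul_left,
      covariance_self hZm.aemeasurable, hZ1, ← hb, mul_one, sub_self]
  have hR0 : ∫ ω, R ω ∂μ = 0 := by
    simp only [hR, Pi.sub_apply, Pi.smul_apply, smul_eq_mul]
    rw [integral_sub hXi (hZi.const_mul b), integral_const_mul, hX0, hZ0]
    simp
  have hRB : ∫ ω in Z ⁻¹' B, R ω ∂μ = 0 := by
    have h := Indep.setIntegral_eq_mul (f := id) hZm.comap_le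
      ((IndepFun_iff_Indep _ _ _).1 (hRZ.indepFun_of_covariance_eq_zero hcov).symm)
      hRZ.fst.aemeasurable ⟨B, hB, rfl⟩ (by fun_prop)
    simpa [hR0] using h
  simp only [hR, Pi.sub_apply, Pi.smul_apply, smul_eq_mul] at hRB
  rw [integral_sub hXi.integrableOn (hZi.const_mul b).integrableOn, integral_const_mul] at hRB
  linarith

/-- Lower-tail mean of a variable jointly Gaussian with a standardized variable. -/
lemma ProbabilityTheory.HasGaussianLaw.setIntegral_le_eq {Ω : Type*} [MeasurableSpace Ω]
    {μ : Measure Ω} {X Z : Ω → ℝ} (hXZ : HasGaussianLaw (fun ω ↦ (X ω, Z ω)) μ)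
    (hZm : Measurable Z) (hX0 : μ[X] = 0) (hZ0 : μ[Z] = 0) (hZ1 : Var[Z; μ] = 1)
    {c q : ℝ} (hc : (μ {ω | Z ω ≤ c}).toReal = cdf (gaussianReal 0 1) q) :
    ∫ ω in {ω | Z ω ≤ c}, X ω ∂μ = -(cov[X, Z; μ] * stdNormalPDF q) := by
  have hlaw : μ.map Z = gaussianReal 0 1 := by
    rw [hXZ.snd.map_eq_gaussianReal, hZ0, hZ1, Real.toNNReal_one]
  have hcq : c = q := by
    refine (strictMono_cdf_gaussianReal 0 one_ne_zero).injective ?_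
    rw [← hc, cdf_eq_real, ← hlaw, map_measureReal_apply hZm measurableSet_Iic]
    rfl
  have h := hXZ.setIntegral_eq_covariance_mul hZm hX0 hZ0 hZ1 (measurableSet_Iic (a := c))
  have hZ : ∫ ω in Z ⁻¹' Set.Iic c, Z ω ∂μ = -stdNormalPDF q := by
    rw [← hcq, ← setIntegral_Iic_gaussianReal, ← hlaw,
      setIntegral_map measurableSet_Iic (by fun_prop) hZm.aemeasurable]
  rw [hZ] at h
  rw [← mul_neg]
  exact h

/-- Moments of the return error and the observed signal, for independent centered Gaussians. -/
lemma reversal_moments {Ω : Type*} [MeasurableSpace Ω] {μ : Measure Ω}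
    {s δm δt δp : Ω → ℝ} (hindep : iIndepFun ![s, δm, δt, δp] μ) {v w : NNReal}
    (hs : HasLaw s (gaussianReal 0 v) μ) (hδm : HasLaw δm (gaussianReal 0 w) μ)
    (hδt : HasLaw δt (gaussianReal 0 w) μ) (hδp : HasLaw δp (gaussianReal 0 w) μ) :
    HasGaussianLaw (fun ω ↦ ((δp - δt) ω, (s + (δt - δm)) ω)) μ ∧
    μ[δp - δt] = 0 ∧ μ[s + (δt - δm)] = 0 ∧
    Var[s + (δt - δm); μ] = v + 2 * w ∧ cov[δp - δt, s + (δt - δm); μ] = -w := by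
  have := hindep.isProbabilityMeasure
  have gs := hs.hasGaussianLaw
  have gm := hδm.hasGaussianLaw
  have gt := hδt.hasGaussianLaw
  have gp := hδp.hasGaussianLaw
  have mean {X : Ω → ℝ} {u : NNReal} (h : HasLaw X (gaussianReal 0 u) μ) : ∫ ω, X ω ∂μ = 0 := by
    rw [h.integral_eq, integral_id_gaussianReal]
  have var {X : Ω → ℝ} {u : NNReal} (h : HasLaw X (gaussianReal 0 u) μ) :
      cov[X, X; μ] = u := by
    rw [covariance_self h.aemeasurable, h.variance_eq, variance_id_gaussianReal]
  have Ls := gs.memLp_two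
  have Lm := gm.memLp_two
  have Lt := gt.memLp_two
  have Lp := gp.memLp_two
  have csm : cov[s, δm; μ] = 0 :=
    (hindep.indepFun (i := 0) (j := 1) (by decide)).covariance_eq_zero Ls Lm
  have cst : cov[s, δt; μ] = 0 :=
    (hindep.indepFun (i := 0) (j := 2) (by decide)).covariance_eq_zero Ls Lt
  have csp : cov[s, δp; μ] = 0 :=
    (hindep.indepFun (i := 0) (j := 3) (by decide)).covariance_eq_zero Ls Lp
  have cmt : cov[δm, δt; μ] = 0 :=
    (hindep.indepFun (i := 1) (j := 2) (by decide)).covariance_eq_zero Lm Lt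
  have cmp : cov[δm, δp; μ] = 0 :=
    (hindep.indepFun (i := 1) (j := 3) (by decide)).covariance_eq_zero Lm Lp
  have ctp : cov[δt, δp; μ] = 0 :=
    (hindep.indepFun (i := 2) (j := 3) (by decide)).covariance_eq_zero Lt Lp
  refine ⟨?_, ?_, ?_, ?_, ?_⟩
  · have hall : ∀ i, HasGaussianLaw (![s, δm, δt, δp] i) μ := by
      intro i
      fin_cases i <;> assumption
    let pr (i : Fin 4) : (Fin 4 → ℝ) →L[ℝ] ℝ := ContinuousLinearMap.proj i
    exact (hindep.hasGaussianLaw hall).map ((pr 3 - pr 2).prod (pr 0 + (pr 2 - pr 1)))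
  · rw [integral_sub' gp.integrable gt.integrable, mean hδp, mean hδt, sub_zero]
  · rw [integral_add' gs.integrable (gt.integrable.sub gm.integrable),
      integral_sub' gt.integrable gm.integrable, mean hs, mean hδt, mean hδm]
    simp
  · rw [← covariance_self (by fun_prop), covariance_add_left Ls (Lt.sub Lm) (Ls.add (Lt.sub Lm)),
      covariance_add_right Ls Ls (Lt.sub Lm), covariance_add_right (Lt.sub Lm) Ls (Lt.sub Lm),
      covariance_sub_sub Lt Lm Lt Lm, covariance_sub_right Ls Lt Lm, covariance_sub_left Lt Lm Ls,
      covariance_comm δt s, covariance_comm δm s, covariance_comm δt δm, csm, cst, cmt,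
      var hs, var hδt, var hδm]
    ring
  · rw [covariance_add_right (Lp.sub Lt) Ls (Lt.sub Lm), covariance_sub_left Lp Lt Ls,
      covariance_sub_sub Lp Lt Lt Lm, covariance_comm δp s, covariance_comm δt s,
      covariance_comm δp δt, covariance_comm δp δm, covariance_comm δt δm,
      csp, cst, ctp, cmp, cmt, var hδt]
    ring

/-- Reversal signals: with `s, δ_{t−1}, δ_t, δ_{t+1}` mutually independent centered Gaussians,
reversal signal error `η = δ_t − δ_{t−1}`, observed signal `ŝ = s + η`,
`σ_ŝ = √(σ_s² + 2σ_δ²)`, noise share `ρ = √2·σ_δ/σ_ŝ`, return error `ε = δ_{t+1} − δ_t`, and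
`c_L`, `c_S` the upper/lower `α`-quantiles of `ŝ`, the long–short bias equals
`−√2·κ(α)·ρ·σ_δ`; in particular its magnitude is `√2·κ(α)·ρ·σ_δ`
(`κ(α) = φ(Φ⁻¹(α))/α`, encoded via `Φ(q) = α`). -/
theorem reversal_signal_bias
    {Ω : Type*} [MeasurableSpace Ω] (μ : Measure Ω) [IsProbabilityMeasure μ]
    (s δm δt δp : Ω → ℝ)
    (hs : Measurable s) (hδm : Measurable δm) (hδt : Measurable δt) (hδp : Measurable δp)
    (hindep : iIndepFun ![s, δm, δt, δp] μ)
    (σs2 σδ : ℝ) (hσs2 : 0 ≤ σs2) (hσδ : 0 < σδ)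
    (hslaw : μ.map s = gaussianReal 0 σs2.toNNReal)
    (hδmlaw : μ.map δm = gaussianReal 0 ((σδ ^ 2).toNNReal))
    (hδtlaw : μ.map δt = gaussianReal 0 ((σδ ^ 2).toNNReal))
    (hδplaw : μ.map δp = gaussianReal 0 ((σδ ^ 2).toNNReal))
    (η shat ε : Ω → ℝ)
    (hηdef : ∀ ω, η ω = δt ω - δm ω)
    (hshat : ∀ ω, shat ω = s ω + η ω)
    (hεdef : ∀ ω, ε ω = δp ω - δt ω)
    (σshat ρ : ℝ)
    (hσshat : σshat = Real.sqrt (σs2 + 2 * σδ ^ 2))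
    (hρ : ρ = Real.sqrt 2 * σδ / σshat)
    (α : ℝ) (hα : α ∈ Set.Ioo (0 : ℝ) 1)
    (q : ℝ) (hq : cdf (gaussianReal 0 1) q = α)
    (cL cS : ℝ)
    (hcL : (μ {ω | cL ≤ shat ω}).toReal = α)
    (hcS : (μ {ω | shat ω ≤ cS}).toReal = α) :
    condMean μ {ω | cL ≤ shat ω} ε - condMean μ {ω | shat ω ≤ cS} ε
      = -(Real.sqrt 2 * (stdNormalPDF q / α) * ρ * σδ) ∧
    |condMean μ {ω | cL ≤ shat ω} ε - condMean μ {ω | shat ω ≤ cS} ε|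
      = Real.sqrt 2 * (stdNormalPDF q / α) * ρ * σδ := by
  obtain ⟨hα0, -⟩ := hα
  have hV : 0 < σs2 + 2 * σδ ^ 2 := by positivity
  have hσ : 0 < σshat := hσshat ▸ Real.sqrt_pos.2 hV
  have hσ2 : σshat ^ 2 = σs2 + 2 * σδ ^ 2 := by rw [hσshat, Real.sq_sqrt hV.le]
  obtain ⟨hG, hε0, hS0, hSv, hcov⟩ := reversal_moments hindep ⟨hs.aemeasurable, hslaw⟩
    ⟨hδm.aemeasurable, hδmlaw⟩ ⟨hδt.aemeasurable, hδtlaw⟩ ⟨hδp.aemeasurable, hδplaw⟩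
  obtain rfl : η = δt - δm := funext hηdef
  obtain rfl : shat = s + (δt - δm) := funext hshat
  obtain rfl : ε = δp - δt := funext hεdef
  rw [Real.coe_toNNReal _ hσs2, Real.coe_toNNReal _ (sq_nonneg σδ), ← hσ2] at hSv
  rw [Real.coe_toNNReal _ (sq_nonneg σδ)] at hcov
  have hSm : Measurable (s + (δt - δm)) := hs.add (hδt.sub hδm)
  generalize s + (δt - δm) = S at *
  generalize δp - δt = E at *
  have scaled (k : ℝ) (hk : k ^ 2 = (σshat ^ 2)⁻¹) {c : ℝ}
      (hc : (μ {ω | k * S ω ≤ c}).toReal = α) :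
      ∫ ω in {ω | k * S ω ≤ c}, E ω ∂μ = k * σδ ^ 2 * stdNormalPDF q := by
    have hGk : HasGaussianLaw (fun ω ↦ (E ω, k * S ω)) μ :=
      hG.map ((ContinuousLinearMap.fst ℝ ℝ ℝ).prod (k • ContinuousLinearMap.snd ℝ ℝ ℝ))
    have h := hGk.setIntegral_le_eq (hSm.const_mul k) hε0
      (by rw [integral_const_mul, hS0, mul_zero])
      (by rw [variance_const_mul, hSv, hk, inv_mul_cancel₀ (by positivity)])
      (hc.trans hq.symm)
    rw [h, covariance_const_mul_right, hcov]
    ring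
  have hsetS : {ω | S ω ≤ cS} = {ω | σshat⁻¹ * S ω ≤ σshat⁻¹ * cS} := by
    ext ω
    exact (mul_le_mul_iff_right₀ (inv_pos.2 hσ)).symm
  have hsetL : {ω | cL ≤ S ω} = {ω | -σshat⁻¹ * S ω ≤ -σshat⁻¹ * cL} := by
    ext ω
    simp only [Set.mem_ofPred_eq, neg_mul, neg_le_neg_iff]
    exact (mul_le_mul_iff_right₀ (inv_pos.2 hσ)).symm
  have hS := scaled σshat⁻¹ (inv_pow _ _) (hsetS ▸ hcS)
  have hL := scaled (-σshat⁻¹) (by rw [neg_sq, inv_pow]) (hsetL ▸ hcL)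
  rw [← hsetS] at hS
  rw [← hsetL] at hL
  have key : condMean μ {ω | cL ≤ S ω} E - condMean μ {ω | S ω ≤ cS} E
      = -(Real.sqrt 2 * (stdNormalPDF q / α) * ρ * σδ) := by
    have h2 : Real.sqrt 2 * Real.sqrt 2 = 2 := Real.mul_self_sqrt two_pos.le
    rw [condMean, condMean, hcL, hcS, hS, hL, hρ]
    linear_combination (σδ ^ 2 * stdNormalPDF q / α * σshat⁻¹) * h2
  have hφ := stdNormalPDF_nonneg q
  have hρ0 : 0 ≤ ρ := by rw [hρ]; positivity
  exact ⟨key, by rw [key, abs_neg, abs_of_nonneg (by positivity)]⟩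

end
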